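/- arXiv:1807.10971 — 3 statements merged into one kernel-verified Lean document; each statement's English description precedes it below -/
import Mathlib

section
/- Let n ≥ 4 be an even integer. Then sup{ r > 0 | for all r' with 0 < r' < r and all p ∈ P_n, the set B(p, r') ∩ P_n is connected } = 2·cos(π/n), where B(p, r') denotes the open Euclidean ball of radius r' centered at p. -/
noncomputable section

/-- The primitive `n`-th root of unity `ω = exp(2πi/n)`. -/
def nroot (n : ℕ) : ℂ := Complex.exp (2 * Real.pi * Complex.I / n)

/-- The boundary of the regular `n`-gon inscribed in the unit circle, as a subset of `ℂ`:
the union of the closed segments from `ω^j` to `ω^(j+1)` for `j = 0, …, n-1`. -/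
def polygon (n : ℕ) : Set ℂ :=
  ⋃ j ∈ Finset.range n, segment ℝ ((nroot n) ^ j) ((nroot n) ^ (j + 1))

end

namespace RegularPolygon

open Real

noncomputable section

/-- The `k`-th vertex `exp (2πik/n)` of the regular `n`-gon, indexed by the integers. -/
def vertex (n : ℕ) (k : ℤ) : ℂ := Complex.exp ((2 * k * (π / n) : ℝ) * Complex.I)

/-- The edge of the regular `n`-gon from the `k`-th to the next vertex. -/
def edge (n : ℕ) (k : ℤ) : Set ℂ := segment ℝ (vertex n k) (vertex n (k + 1))

/-- The rotation of the plane taking the `k`-th edge to the vertical edge to the right of `0`. -/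
def frame (n : ℕ) (k : ℤ) (z : ℂ) : ℂ :=
  z * Complex.exp ((-((2 * k + 1) * (π / n)) : ℝ) * Complex.I)

end

variable {n : ℕ} {k : ℤ} {p q : ℂ} {r : ℝ}

lemma vertex_add_mul (hn : n ≠ 0) (k z : ℤ) : vertex n (k + n * z) = vertex n k := by
  have h : (n : ℝ) ≠ 0 := by exact_mod_cast hn
  have h2 : (2 * ((k + n * z : ℤ) : ℝ) * (π / n) : ℝ) = 2 * k * (π / n) + z * (2 * π) := by
    push_cast
    field_simp
  rw [vertex, vertex, h2, Complex.exp_eq_exp_iff_exists_int]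
  exact ⟨z, by push_cast; ring⟩

lemma edge_add_mul (hn : n ≠ 0) (k z : ℤ) : edge n (k + n * z) = edge n k := by
  rw [edge, edge, vertex_add_mul hn, show k + n * z + 1 = k + 1 + n * z by ring,
    vertex_add_mul hn]

lemma nroot_pow (n j : ℕ) : nroot n ^ j = vertex n j := by
  rw [nroot, vertex, ← Complex.exp_nat_mul]
  congr 1
  push_cast
  ring

lemma mem_polygon_iff : p ∈ polygon n ↔ ∃ j < n, p ∈ edge n (j : ℕ) := by
  simp only [polygon, Set.mem_iUnion, Finset.mem_range, exists_prop, nroot_pow, edge]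
  push_cast
  rfl

lemma edge_subset_polygon (hn : n ≠ 0) (k : ℤ) : edge n k ⊆ polygon n := by
  intro p hp
  have h0 : (n : ℤ) ≠ 0 := by exact_mod_cast hn
  refine mem_polygon_iff.2 ⟨(k % n).toNat, ?_, ?_⟩
  · have := Int.emod_lt_of_pos k (show (0 : ℤ) < n by omega)
    have := Int.emod_nonneg k h0
    omega
  · rw [Int.toNat_of_nonneg (Int.emod_nonneg k h0), ← edge_add_mul hn _ (k / n),
      Int.emod_add_mul_ediv]
    exact hp

lemma exists_mem_edge_add (hn : n ≠ 0) (hp : p ∈ polygon n) (k : ℤ) :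
    ∃ l : ℕ, l < n ∧ p ∈ edge n (k + l) := by
  obtain ⟨j, -, hj⟩ := mem_polygon_iff.1 hp
  have h0 : (n : ℤ) ≠ 0 := by exact_mod_cast hn
  refine ⟨((j - k) % n).toNat, ?_, ?_⟩
  · have := Int.emod_lt_of_pos (j - k) (show (0 : ℤ) < n by omega)
    have := Int.emod_nonneg (j - k) h0
    omega
  · rw [Int.toNat_of_nonneg (Int.emod_nonneg _ h0), ← edge_add_mul hn _ ((j - k) / n), add_assoc,
      Int.emod_add_mul_ediv, add_sub_cancel]
    exact hj

lemma finite_range_vertex (hn : n ≠ 0) : (Set.range (vertex n)).Finite := by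
  have h0 : (n : ℤ) ≠ 0 := by exact_mod_cast hn
  refine ((Set.finite_Ico (0 : ℤ) n).image (vertex n)).subset ?_
  rintro _ ⟨k, rfl⟩
  refine ⟨k % n, ⟨Int.emod_nonneg k h0, Int.emod_lt_of_pos k (by omega)⟩, ?_⟩
  rw [← vertex_add_mul hn _ (k / n), Int.emod_add_mul_ediv]

lemma left_mem_edge (n : ℕ) (k : ℤ) : vertex n k ∈ edge n k := left_mem_segment ℝ _ _

lemma right_mem_edge (n : ℕ) (k : ℤ) : vertex n (k + 1) ∈ edge n k := right_mem_segment ℝ _ _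

lemma frame_vertex (n : ℕ) (k l : ℤ) :
    frame n k (vertex n (k + l)) = Complex.exp (((2 * l - 1) * (π / n) : ℝ) * Complex.I) := by
  rw [frame, vertex, ← Complex.exp_add]
  congr 1
  push_cast
  ring

lemma frame_vertex_re (n : ℕ) (k l : ℤ) :
    (frame n k (vertex n (k + l))).re = cos ((2 * l - 1) * (π / n)) := by
  rw [frame_vertex, Complex.exp_ofReal_mul_I_re]

lemma frame_vertex_im (n : ℕ) (k l : ℤ) :
    (frame n k (vertex n (k + l))).im = sin ((2 * l - 1) * (π / n)) := by
  rw [frame_vertex, Complex.exp_ofReal_mul_I_im]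

lemma frame_smul_add (n : ℕ) (k : ℤ) (a b : ℝ) (p q : ℂ) :
    frame n k (a • p + b • q) = a • frame n k p + b • frame n k q := by
  simp only [frame, Complex.real_smul]
  ring

lemma continuous_frame (n : ℕ) (k : ℤ) : Continuous (frame n k) := by
  unfold frame
  fun_prop

lemma dist_sq_eq (n : ℕ) (k : ℤ) (p q : ℂ) :
    dist p q ^ 2 = ((frame n k p).re - (frame n k q).re) ^ 2 +
      ((frame n k p).im - (frame n k q).im) ^ 2 := by
  have h : dist p q = ‖frame n k p - frame n k q‖ := by
    rw [frame, frame, ← sub_mul, norm_mul, Complex.norm_exp_ofReal_mul_I, mul_one, dist_eq_norm]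
  rw [h, Complex.sq_norm, Complex.normSq_apply, Complex.sub_re, Complex.sub_im]
  ring

lemma frame_left (n : ℕ) (k : ℤ) :
    (frame n k (vertex n k)).re = cos (π / n) ∧ (frame n k (vertex n k)).im = -sin (π / n) := by
  have h1 := frame_vertex_re n k 0
  have h2 := frame_vertex_im n k 0
  simp only [add_zero, Int.cast_zero, mul_zero, zero_sub, neg_mul, one_mul, cos_neg, sin_neg]
    at h1 h2
  exact ⟨h1, h2⟩

lemma frame_right (n : ℕ) (k : ℤ) : (frame n k (vertex n (k + 1))).re = cos (π / n) ∧
    (frame n k (vertex n (k + 1))).im = sin (π / n) := by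
  have h1 := frame_vertex_re n k 1
  have h2 := frame_vertex_im n k 1
  norm_num at h1 h2
  exact ⟨h1, h2⟩

lemma sin_pi_div_pos (hn : 4 ≤ n) : 0 < sin (π / n) := by
  have : (4 : ℝ) ≤ n := by exact_mod_cast hn
  refine sin_pos_of_pos_of_lt_pi (by positivity) ?_
  exact div_lt_self pi_pos (by linarith)

lemma sin_le_cos (hn : 4 ≤ n) : sin (π / n) ≤ cos (π / n) := by
  have h4 : (4 : ℝ) ≤ n := by exact_mod_cast hn
  have h0 : 0 < π / n := by positivity
  have h : π / n ≤ π / 4 := div_le_div_of_nonneg_left pi_pos.le (by norm_num) h4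
  rw [← sin_pi_div_two_sub]
  exact sin_le_sin_of_le_of_le_pi_div_two (by linarith) (by linarith) (by linarith)

lemma frame_of_mem_edge (hn : 4 ≤ n) (hq : q ∈ edge n k) :
    (frame n k q).re = cos (π / n) ∧ |(frame n k q).im| ≤ sin (π / n) := by
  obtain ⟨a, b, ha, hb, hab, rfl⟩ := hq
  have hs := sin_pi_div_pos hn
  rw [frame_smul_add, Complex.add_re, Complex.add_im, Complex.smul_re, Complex.smul_re,
    Complex.smul_im, Complex.smul_im, (frame_left n k).1, (frame_left n k).2, (frame_right n k).1,
    (frame_right n k).2, ← add_smul, hab, one_smul, abs_le, smul_eq_mul, smul_eq_mul]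
  exact ⟨rfl, by nlinarith, by nlinarith⟩

lemma frame_neg (n : ℕ) (k : ℤ) (p : ℂ) : frame n k (-p) = -frame n k p := neg_mul _ _

lemma vertex_add_half {m : ℕ} (hm : m ≠ 0) (k : ℤ) :
    vertex (2 * m) (k + m) = -vertex (2 * m) k := by
  have hm' : (m : ℂ) ≠ 0 := by exact_mod_cast hm
  rw [vertex, vertex, ← Complex.exp_add_pi_mul_I]
  congr 1
  push_cast
  field_simp

lemma neg_mem_edge_iff {m : ℕ} (hm : m ≠ 0) : -p ∈ edge (2 * m) k ↔ p ∈ edge (2 * m) (k + m) := by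
  have h : edge (2 * m) (k + m) = -edge (2 * m) k := by
    rw [edge, edge, add_right_comm, vertex_add_half hm, vertex_add_half hm]
    simpa using (image_segment ℝ (-LinearMap.id : ℂ →ₗ[ℝ] ℂ).toAffineMap (vertex (2 * m) k)
      (vertex (2 * m) (k + 1))).symm
  rw [h, Set.mem_neg]

lemma frame_re_of_mem_edge_add {m : ℕ} (hm : 2 ≤ m) (hp : p ∈ edge (2 * m) (k + m)) :
    (frame (2 * m) k p).re = -cos (π / (2 * m : ℕ)) := by
  rw [← (frame_of_mem_edge (by omega) ((neg_mem_edge_iff (by omega)).2 hp)).1, frame_neg,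
    Complex.neg_re, neg_neg]

lemma sin_le_sin_of_mem_Icc {x y : ℝ} (hx : 0 ≤ x) (hx2 : x ≤ π / 2) (h1 : x ≤ y)
    (h2 : y ≤ π - x) : sin x ≤ sin y := by
  rcases le_total y (π / 2) with h | h
  · exact sin_le_sin_of_le_of_le_pi_div_two (by linarith) h h1
  · rw [← sin_pi_sub y]
    exact sin_le_sin_of_le_of_le_pi_div_two (by linarith) (by linarith) (by linarith)

/-- Every point of a regular polygon with an even number of edges lies on a given edge, on the
opposite one, or outside the open strip bounded by the perpendiculars at the ends of the edge. -/
lemma mem_edge_or_mem_opposite_or_le_abs {m : ℕ} (hm : 2 ≤ m) (hp : p ∈ polygon (2 * m)) (k : ℤ) :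
    p ∈ edge (2 * m) k ∨ p ∈ edge (2 * m) (k + m) ∨
      sin (π / (2 * m : ℕ)) ≤ |(frame (2 * m) k p).im| := by
  obtain ⟨l, hl, hpl⟩ := exists_mem_edge_add (by omega) hp k
  rcases Nat.eq_zero_or_pos l with rfl | hl0
  · left; simpa using hpl
  rcases eq_or_ne l m with rfl | hlm
  · exact .inr (.inl hpl)
  refine .inr (.inr ?_)
  obtain ⟨a, b, ha, hb, hab, rfl⟩ := hpl
  obtain rfl : b = 1 - a := by linarith
  rw [frame_smul_add, Complex.add_im, Complex.smul_im, Complex.smul_im, add_assoc,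
    frame_vertex_im, frame_vertex_im, smul_eq_mul, smul_eq_mul]
  have hm2 : (2 : ℝ) ≤ m := by exact_mod_cast hm
  set φ := π / (2 * m : ℕ) with hφ
  have hπ : π = 2 * m * φ := by rw [hφ]; push_cast; field_simp
  have hφ0 : 0 < φ := by rw [hφ]; positivity
  have hφ2 : φ ≤ π / 2 := by rw [hπ]; nlinarith
  push_cast
  have hl1 : (1 : ℝ) ≤ l := by exact_mod_cast hl0
  rcases lt_or_gt_of_ne hlm with h | h
  · have h' : (l : ℝ) + 1 ≤ m := by exact_mod_cast h
    have h1 : sin φ ≤ sin ((2 * l - 1) * φ) :=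
      sin_le_sin_of_mem_Icc hφ0.le hφ2 (by nlinarith) (by nlinarith)
    have h2 : sin φ ≤ sin ((2 * (l + 1) - 1) * φ) :=
      sin_le_sin_of_mem_Icc hφ0.le hφ2 (by nlinarith) (by nlinarith)
    refine le_trans ?_ (le_abs_self _)
    nlinarith [mul_le_mul_of_nonneg_left h1 ha, mul_le_mul_of_nonneg_left h2 hb]
  · have h' : (m : ℝ) + 1 ≤ l := by exact_mod_cast h
    have h'' : (l : ℝ) + 1 ≤ 2 * m := by exact_mod_cast hl
    have h1 : sin φ ≤ sin ((2 * l - 1) * φ - π) :=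
      sin_le_sin_of_mem_Icc hφ0.le hφ2 (by nlinarith) (by nlinarith)
    have h2 : sin φ ≤ sin ((2 * (l + 1) - 1) * φ - π) :=
      sin_le_sin_of_mem_Icc hφ0.le hφ2 (by nlinarith) (by nlinarith)
    rw [sin_sub_pi] at h1 h2
    refine le_trans ?_ (neg_le_abs _)
    nlinarith [mul_le_mul_of_nonneg_left h1 ha, mul_le_mul_of_nonneg_left h2 hb]

lemma le_dist_of_mem_opposite {m : ℕ} (hm : 2 ≤ m) (hq : q ∈ edge (2 * m) k)
    (hp : p ∈ edge (2 * m) (k + m)) : 2 * cos (π / (2 * m : ℕ)) ≤ dist q p := by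
  have h1 := (frame_of_mem_edge (by omega) hq).1
  have h2 := frame_re_of_mem_edge_add hm hp
  have h3 := dist_sq_eq (2 * m) k q p
  rw [h1, h2] at h3
  refine le_of_pow_le_pow_left₀ two_ne_zero dist_nonneg ?_
  nlinarith [sq_nonneg ((frame (2 * m) k q).im - (frame (2 * m) k p).im)]

lemma norm_le_one_of_mem_polygon (hp : p ∈ polygon n) : ‖p‖ ≤ 1 := by
  obtain ⟨j, -, hj⟩ := mem_polygon_iff.1 hp
  have h (k : ℤ) : vertex n k ∈ Metric.closedBall (0 : ℂ) 1 := by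
    rw [mem_closedBall_zero_iff, vertex, Complex.norm_exp_ofReal_mul_I]
  simpa using (convex_closedBall (0 : ℂ) 1).segment_subset (h _) (h _) hj

/-- At a vertex other than `p`, one of the two incident edges starts in the direction of `p`. -/
lemma neg_sin_lt_or_lt_sin (hn : 4 ≤ n) (hp : p ∈ polygon n) (hpk : p ≠ vertex n k) :
    -sin (π / n) < (frame n k p).im ∨ (frame n (k - 1) p).im < sin (π / n) := by
  have hs := sin_pi_div_pos hn
  set z := p * Complex.exp ((-(2 * k * (π / n)) : ℝ) * Complex.I) with hz
  have hzn : ‖z‖ ≤ 1 := by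
    rw [hz, norm_mul, Complex.norm_exp_ofReal_mul_I, mul_one]
    exact norm_le_one_of_mem_polygon hp
  have hz1 : z ≠ 1 := by
    intro h
    apply hpk
    rw [hz, Complex.ofReal_neg, neg_mul, Complex.exp_neg, ← div_eq_mul_inv,
      div_eq_one_iff_eq (Complex.exp_ne_zero _)] at h
    exact h
  have hzre : z.re < 1 := by
    refine lt_of_le_of_ne ((Complex.re_le_norm z).trans hzn) fun h => hz1 ?_
    have h2 : z.re * z.re + z.im * z.im ≤ 1 := by
      rw [← Complex.normSq_apply, ← Complex.sq_norm]
      exact pow_le_one₀ (norm_nonneg _) hzn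
    refine Complex.ext h ?_
    rw [h] at h2
    simpa using show z.im = 0 by nlinarith [mul_self_nonneg z.im]
  have h1 : frame n k p = z * Complex.exp ((-(π / n) : ℝ) * Complex.I) := by
    rw [frame, hz, mul_assoc, ← Complex.exp_add]
    congr 2
    push_cast
    ring
  have h2 : frame n (k - 1) p = z * Complex.exp ((π / n : ℝ) * Complex.I) := by
    rw [frame, hz, mul_assoc, ← Complex.exp_add]
    congr 2
    push_cast
    ring
  clear_value z
  rw [h1, h2, Complex.mul_im, Complex.mul_im, Complex.exp_ofReal_mul_I_re,
    Complex.exp_ofReal_mul_I_im, Complex.exp_ofReal_mul_I_re, Complex.exp_ofReal_mul_I_im,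
    cos_neg, sin_neg]
  by_contra! h
  nlinarith [mul_pos hs (sub_pos.2 hzre)]

lemma dist_right_le (hn : 4 ≤ n) (hq : q ∈ edge n k) (hp : sin (π / n) ≤ (frame n k p).im) :
    dist (vertex n (k + 1)) p ≤ dist q p := by
  obtain ⟨h1, h2⟩ := frame_of_mem_edge hn hq
  rw [abs_le] at h2
  refine le_of_pow_le_pow_left₀ two_ne_zero dist_nonneg ?_
  rw [dist_sq_eq n k, dist_sq_eq n k, (frame_right n k).1, (frame_right n k).2, h1]
  nlinarith

lemma dist_left_le (hn : 4 ≤ n) (hq : q ∈ edge n k) (hp : (frame n k p).im ≤ -sin (π / n)) :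
    dist (vertex n k) p ≤ dist q p := by
  obtain ⟨h1, h2⟩ := frame_of_mem_edge hn hq
  rw [abs_le] at h2
  refine le_of_pow_le_pow_left₀ two_ne_zero dist_nonneg ?_
  rw [dist_sq_eq n k, dist_sq_eq n k, (frame_left n k).1, (frame_left n k).2, h1]
  nlinarith

lemma dist_right_lt_dist_left (hn : 4 ≤ n) (hp : sin (π / n) ≤ (frame n k p).im) :
    dist (vertex n (k + 1)) p < dist (vertex n k) p := by
  refine lt_of_pow_lt_pow_left₀ 2 dist_nonneg ?_
  have hs := sin_pi_div_pos hn
  rw [dist_sq_eq n k, dist_sq_eq n k, (frame_right n k).1, (frame_right n k).2,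
    (frame_left n k).1, (frame_left n k).2]
  nlinarith

lemma dist_left_lt_dist_right (hn : 4 ≤ n) (hp : (frame n k p).im ≤ -sin (π / n)) :
    dist (vertex n k) p < dist (vertex n (k + 1)) p := by
  refine lt_of_pow_lt_pow_left₀ 2 dist_nonneg ?_
  have hs := sin_pi_div_pos hn
  rw [dist_sq_eq n k, dist_sq_eq n k, (frame_right n k).1, (frame_right n k).2,
    (frame_left n k).1, (frame_left n k).2]
  nlinarith

lemma joinedIn_of_mem_edge (hn : n ≠ 0) {x y c : ℂ} (hx : x ∈ edge n k) (hy : y ∈ edge n k)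
    (hxr : x ∈ Metric.ball c r) (hyr : y ∈ Metric.ball c r) :
    JoinedIn (Metric.ball c r ∩ polygon n) x y :=
  JoinedIn.of_segment_subset <| Set.subset_inter
    ((convex_ball c r).segment_subset hxr hyr)
    (((convex_segment _ _).segment_subset hx hy).trans (edge_subset_polygon hn k))

lemma joinedIn_vertex {m : ℕ} (hm : 2 ≤ m) (hp : p ∈ polygon (2 * m))
    (hr : r ≤ 2 * cos (π / (2 * m : ℕ))) (hk : vertex (2 * m) k ∈ Metric.ball p r) :
    JoinedIn (Metric.ball p r ∩ polygon (2 * m)) p (vertex (2 * m) k) := by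
  have hn : 2 * m ≠ 0 := by omega
  have hn4 : 4 ≤ 2 * m := by omega
  have hpp : p ∈ Metric.ball p r := Metric.mem_ball_self (dist_nonneg.trans_lt hk)
  by_contra hnot
  obtain ⟨_, ⟨⟨j, rfl⟩, hjr, hj⟩, hmin⟩ := Set.exists_min_image
    {z ∈ Set.range (vertex (2 * m)) | z ∈ Metric.ball p r ∧
      ¬ JoinedIn (Metric.ball p r ∩ polygon (2 * m)) p z} (fun z => dist z p)
    ((finite_range_vertex hn).subset (Set.sep_subset _ _)) ⟨_, ⟨k, rfl⟩, hk, hnot⟩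
  -- A strictly closer vertex on a common edge would already be joined to `p`.
  have key (i l : ℤ) (h1 : vertex (2 * m) j ∈ edge (2 * m) i)
      (h2 : vertex (2 * m) l ∈ edge (2 * m) i)
      (h : dist (vertex (2 * m) l) p < dist (vertex (2 * m) j) p) : False := by
    have hlr : vertex (2 * m) l ∈ Metric.ball p r := h.trans hjr
    by_cases hl : JoinedIn (Metric.ball p r ∩ polygon (2 * m)) p (vertex (2 * m) l)
    · exact hj (hl.trans (joinedIn_of_mem_edge hn h2 h1 hlr hjr))
    · exact (hmin _ ⟨⟨l, rfl⟩, hlr, hl⟩).not_gt h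
  -- Neither an edge through the minimal vertex nor the opposite edge contains `p`.
  have strip (i : ℤ) (hi : vertex (2 * m) j ∈ edge (2 * m) i) :
      sin (π / (2 * m : ℕ)) ≤ |(frame (2 * m) i p).im| := by
    rcases mem_edge_or_mem_opposite_or_le_abs hm hp i with h | h | h
    · exact (hj (joinedIn_of_mem_edge hn h hi hpp hjr)).elim
    · exact absurd (le_dist_of_mem_opposite hm hi h) (hjr.trans_le hr).not_ge
    · exact h
  have hj' : vertex (2 * m) j ∈ edge (2 * m) (j - 1) := by
    simpa using right_mem_edge (2 * m) (j - 1)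
  have hpj : p ≠ vertex (2 * m) j := by
    rintro h
    exact hj (h ▸ JoinedIn.refl ⟨hpp, hp⟩)
  rcases neg_sin_lt_or_lt_sin hn4 hp hpj with h | h
  · rcases le_abs.1 (strip j (left_mem_edge _ j)) with h' | h'
    · exact key j (j + 1) (left_mem_edge _ _) (right_mem_edge _ _) (dist_right_lt_dist_left hn4 h')
    · linarith
  · rcases le_abs.1 (strip (j - 1) hj') with h' | h'
    · linarith
    · have := dist_left_lt_dist_right (k := j - 1) (p := p) hn4 (by linarith)
      rw [sub_add_cancel] at this
      exact key (j - 1) (j - 1) hj' (left_mem_edge _ _) this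

lemma isConnected_ball_inter {m : ℕ} (hm : 2 ≤ m) (hp : p ∈ polygon (2 * m)) (hr0 : 0 < r)
    (hr : r ≤ 2 * cos (π / (2 * m : ℕ))) : IsConnected (Metric.ball p r ∩ polygon (2 * m)) := by
  have hn : 2 * m ≠ 0 := by omega
  have hn4 : 4 ≤ 2 * m := by omega
  have hpp : p ∈ Metric.ball p r := Metric.mem_ball_self hr0
  refine IsPathConnected.isConnected ⟨p, ⟨hpp, hp⟩, ?_⟩
  rintro q ⟨hqr, hq⟩
  obtain ⟨j, -, hj⟩ := mem_polygon_iff.1 hq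
  have join (l : ℤ) (hl : vertex (2 * m) l ∈ edge (2 * m) j)
      (hd : dist (vertex (2 * m) l) p ≤ dist q p) :
      JoinedIn (Metric.ball p r ∩ polygon (2 * m)) p q := by
    have hlr : vertex (2 * m) l ∈ Metric.ball p r := hd.trans_lt hqr
    exact (joinedIn_vertex hm hp hr hlr).trans (joinedIn_of_mem_edge hn hl hj hlr hqr)
  rcases mem_edge_or_mem_opposite_or_le_abs hm hp j with h | h | h
  · exact joinedIn_of_mem_edge hn h hj hpp hqr
  · exact absurd (le_dist_of_mem_opposite hm hj h) (hqr.trans_le hr).not_ge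
  · rcases le_abs.1 h with h | h
    · exact join _ (right_mem_edge _ _) (dist_right_le hn4 hj h)
    · exact join _ (left_mem_edge _ _) (dist_left_le hn4 hj (by linarith))

/-- Balls around the midpoint of an edge that reach the opposite edge but not its ends are
disconnected. -/
lemma exists_not_isConnected_ball_inter {m : ℕ} (hm : 2 ≤ m) :
    ∃ p ∈ polygon (2 * m), ∀ r, 2 * cos (π / (2 * m : ℕ)) < r →
      r ^ 2 < 4 * cos (π / (2 * m : ℕ)) ^ 2 + sin (π / (2 * m : ℕ)) ^ 2 →
      ¬ IsConnected (Metric.ball p r ∩ polygon (2 * m)) := by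
  have hn4 : 4 ≤ 2 * m := by omega
  set p := midpoint ℝ (vertex (2 * m) 0) (vertex (2 * m) (0 + 1)) with hpdef
  have hpe : p ∈ edge (2 * m) 0 := midpoint_mem_segment _ _
  have hpP := edge_subset_polygon (by omega) 0 hpe
  have hnP : -p ∈ polygon (2 * m) :=
    edge_subset_polygon (by omega) (0 + m) ((neg_mem_edge_iff (by omega)).1 (by rwa [neg_neg]))
  refine ⟨p, hpP, fun r hr1 hr2 hc => ?_⟩
  have hre := (frame_of_mem_edge hn4 hpe).1
  have him : (frame (2 * m) 0 p).im = 0 := by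
    rw [hpdef, midpoint_eq_smul_add, smul_add, frame_smul_add, Complex.add_im, Complex.smul_im,
      Complex.smul_im, (frame_left _ 0).2, (frame_right _ 0).2]
    simp
  have hs := sin_pi_div_pos hn4
  have hsc := sin_le_cos hn4
  set a := cos (π / (2 * m : ℕ))
  set s := sin (π / (2 * m : ℕ))
  have hpr : p ∈ Metric.ball p r := Metric.mem_ball_self (by linarith)
  have hnr : -p ∈ Metric.ball p r := by
    refine Metric.mem_ball.2 (lt_of_pow_lt_pow_left₀ 2 (by linarith) ?_)
    rw [dist_sq_eq (2 * m) 0, frame_neg, Complex.neg_re, Complex.neg_im, hre, him]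
    nlinarith
  set t := √(r ^ 2 - s ^ 2)
  have ht : t ^ 2 = r ^ 2 - s ^ 2 := sq_sqrt (by nlinarith)
  have ht0 : 0 < t := sqrt_pos.2 (by nlinarith)
  have ht2 : t < 2 * a := lt_of_pow_lt_pow_left₀ 2 (by linarith) (by rw [ht]; linarith)
  have himg := hc.isPreconnected.image (fun z => (frame (2 * m) 0 z).re)
    (Complex.continuous_re.comp (continuous_frame _ _)).continuousOn
  obtain ⟨q, ⟨hqr, hq⟩, hqt⟩ := himg.Icc_subset ⟨-p, ⟨hnr, hnP⟩, rfl⟩ ⟨p, ⟨hpr, hpP⟩, rfl⟩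
    (show a - t ∈ _ by
      simp only [frame_neg, Complex.neg_re, hre]
      constructor <;> linarith)
  simp only at hqt
  rcases mem_edge_or_mem_opposite_or_le_abs hm hq 0 with h | h | h
  · linarith [(frame_of_mem_edge hn4 h).1]
  · linarith [frame_re_of_mem_edge_add hm h]
  · have h1 : dist q p ^ 2 < r ^ 2 := pow_lt_pow_left₀ hqr dist_nonneg two_ne_zero
    rw [dist_sq_eq (2 * m) 0, hre, him, hqt] at h1
    have h2 := pow_le_pow_left₀ hs.le h 2
    rw [sq_abs] at h2
    nlinarith

end RegularPolygon

/-- For an even integer `n ≥ 4`, the supremum of the set of `r > 0` such that for all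
`0 < r' < r` and all `p ∈ P_n`, the set `B(p,r') ∩ P_n` is connected, equals `2 cos(π/n)`. -/
theorem connectivity_scale_even (n : ℕ) (hn : 4 ≤ n) (heven : Even n) :
    sSup {r : ℝ | 0 < r ∧ ∀ r' : ℝ, 0 < r' → r' < r → ∀ p ∈ polygon n,
        IsConnected (Metric.ball p r' ∩ polygon n)} = 2 * Real.cos (Real.pi / n) := by
  obtain ⟨m, rfl⟩ := heven.two_dvd
  have hm : 2 ≤ m := by omega
  have hs := RegularPolygon.sin_pi_div_pos hn
  have hsc := RegularPolygon.sin_le_cos hn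
  refine IsGreatest.csSup_eq ⟨⟨by linarith, fun r' h0 hr p hp =>
    RegularPolygon.isConnected_ball_inter hm hp h0 hr.le⟩, ?_⟩
  rintro r ⟨-, hr⟩
  by_contra! h
  set a := Real.cos (Real.pi / (2 * m : ℕ))
  set s := Real.sin (Real.pi / (2 * m : ℕ))
  obtain ⟨p, hp, hdisc⟩ := RegularPolygon.exists_not_isConnected_ball_inter hm
  have hsqrt : 2 * a < √(4 * a ^ 2 + s ^ 2) := Real.lt_sqrt_of_sq_lt (by nlinarith)
  obtain ⟨r', h1, h2⟩ := exists_between (lt_min h hsqrt)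
  obtain ⟨h2, h3⟩ := lt_min_iff.1 h2
  exact hdisc r' h1 ((Real.lt_sqrt (by linarith)).1 h3) (hr r' (by linarith) h2 p hp)
end

section
/- Let n ≥ 5 be an odd integer. Then sup{ r > 0 | for all r' with 0 < r' < r and all p ∈ P_n, the set B(p, r') ∩ P_n is connected } = 1 + cos(2π/n)/cos(π/n), where B(p, r') denotes the open Euclidean ball of radius r' centered at p. -/
open scoped RealInnerProductSpace

section Cosines

variable {n m : ℕ}

lemma cos_pi_div_pos (hn : 5 ≤ n) : 0 < Real.cos (Real.pi / n) := by
  have hn' : (5 : ℝ) ≤ n := by exact_mod_cast hn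
  have hpi := Real.pi_pos
  apply Real.cos_pos_of_mem_Ioo ⟨by have : 0 < Real.pi / n := by positivity
                                    linarith, ?_⟩
  rw [div_lt_div_iff₀ (by linarith) (by norm_num)]
  nlinarith

lemma cos_two_pi_div_pos (hn : 5 ≤ n) : 0 < Real.cos (2 * Real.pi / n) := by
  have hn' : (5 : ℝ) ≤ n := by exact_mod_cast hn
  have hpi := Real.pi_pos
  apply Real.cos_pos_of_mem_Ioo ⟨by have : 0 < 2 * Real.pi / n := by positivity
                                    linarith, ?_⟩
  rw [div_lt_div_iff₀ (by linarith) (by norm_num)]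
  nlinarith

lemma cos_pi_div_lt_one (hn : 5 ≤ n) : Real.cos (Real.pi / n) < 1 := by
  have hn' : (5 : ℝ) ≤ n := by exact_mod_cast hn
  have hpi := Real.pi_pos
  rw [← Real.cos_zero]
  apply Real.cos_lt_cos_of_nonneg_of_le_pi le_rfl _ (by positivity)
  exact div_le_self hpi.le (by linarith)

lemma cos_two_pi_div (n : ℕ) :
    Real.cos (2 * Real.pi / n) = 2 * Real.cos (Real.pi / n) ^ 2 - 1 := by
  rw [← Real.cos_two_mul, mul_div_assoc]

lemma cos_half_turn (hm : n = 2 * m + 1) :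
    Real.cos (m * (2 * Real.pi / n)) = -Real.cos (Real.pi / n) := by
  rw [← Real.cos_pi_sub]
  congr 1
  subst hm
  push_cast
  field_simp
  ring

lemma cos_half_turn_succ (hm : n = 2 * m + 1) :
    Real.cos ((m + 1) * (2 * Real.pi / n)) = -Real.cos (Real.pi / n) := by
  rw [← Real.cos_add_pi]
  congr 1
  subst hm
  push_cast
  field_simp
  ring

lemma cos_half_turn_pred (hm : n = 2 * m + 1) :
    Real.cos ((m - 1) * (2 * Real.pi / n)) =
      -(4 * Real.cos (Real.pi / n) ^ 3 - 3 * Real.cos (Real.pi / n)) := by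
  rw [← Real.cos_three_mul, ← Real.cos_pi_sub]
  congr 1
  subst hm
  push_cast
  field_simp
  ring

/-- Away from the half turn, consecutive cosines are at least as far apart as the first two. -/
lemma one_sub_cos_le_cos_sub_cos {j : ℕ} (hm : n = 2 * m + 1) (hj : j + 1 ≤ m) :
    1 - Real.cos (2 * Real.pi / n) ≤
      Real.cos (j * (2 * Real.pi / n)) - Real.cos ((j + 1) * (2 * Real.pi / n)) := by
  have hpi := Real.pi_pos
  have hn : (0 : ℝ) < n := by subst hm; positivity
  set b := Real.pi / n with hb
  have hb0 : 0 < b := by positivity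
  have hnb : (2 * m + 1) * b = Real.pi := by
    rw [hb]; subst hm; push_cast; field_simp
  have h2 : 2 * Real.pi / n = 2 * b := by rw [hb]; ring
  have hj' : (j : ℝ) + 1 ≤ m := by exact_mod_cast hj
  have hj0 : (0 : ℝ) ≤ j := by positivity
  have e1 : Real.cos (j * (2 * b)) - Real.cos ((j + 1) * (2 * b)) =
      2 * Real.sin ((2 * j + 1) * b) * Real.sin b := by
    rw [Real.cos_sub_cos,
      show (j * (2 * b) + (j + 1) * (2 * b)) / 2 = (2 * j + 1) * b by ring,
      show (j * (2 * b) - (j + 1) * (2 * b)) / 2 = -b by ring, Real.sin_neg]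
    ring
  have e2 : 1 - Real.cos (2 * b) = 2 * Real.sin b * Real.sin b := by
    rw [Real.cos_two_mul]
    nlinarith [Real.sin_sq_add_cos_sq b]
  have hs : 0 ≤ Real.sin b := Real.sin_nonneg_of_nonneg_of_le_pi hb0.le (by nlinarith)
  have key : Real.sin b ≤ Real.sin ((2 * j + 1) * b) := by
    rw [← Real.cos_sub_pi_div_two b, ← Real.cos_sub_pi_div_two,
      ← Real.cos_abs (b - _), ← Real.cos_abs (_ - Real.pi / 2)]
    apply Real.cos_le_cos_of_nonneg_of_le_pi (abs_nonneg _)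
    · rw [abs_le]; constructor <;> nlinarith
    · rw [abs_of_nonpos (a := b - _) (by nlinarith), abs_le]
      constructor <;> nlinarith
  rw [h2, e1, e2]
  gcongr

end Cosines

section RegularSequence

variable {E : Type*} [NormedAddCommGroup E] [InnerProductSpace ℝ E]
  {n m : ℕ} {V : ℤ → E}

/-- The points `V k` are placed like the vertices of a regular `n`-gon of circumradius one. -/
def IsRegularSequence (n : ℕ) (V : ℤ → E) : Prop :=
  ∀ a b : ℤ, ⟪V a, V b⟫ = Real.cos ((a - b) * (2 * Real.pi / n))

namespace IsRegularSequence

lemma inner_self (hV : IsRegularSequence n V) (a : ℤ) : ⟪V a, V a⟫ = 1 := by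
  rw [hV, sub_self, zero_mul, Real.cos_zero]

lemma inner_succ (hV : IsRegularSequence n V) (a : ℤ) :
    ⟪V a, V (a + 1)⟫ = 2 * Real.cos (Real.pi / n) ^ 2 - 1 := by
  rw [hV, ← cos_two_pi_div, ← Real.cos_neg]
  congr 1
  push_cast
  ring

lemma inner_zero_one (hV : IsRegularSequence n V) :
    ⟪V 0, V 1⟫ = 2 * Real.cos (Real.pi / n) ^ 2 - 1 := by
  simpa using hV.inner_succ 0

lemma inner_zero (hV : IsRegularSequence n V) (j : ℕ) :
    ⟪V 0, V j⟫ = Real.cos (j * (2 * Real.pi / n)) := by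
  rw [hV, ← Real.cos_neg]
  congr 1
  push_cast
  ring

lemma inner_one (hV : IsRegularSequence n V) (j : ℕ) :
    ⟪V 1, V j⟫ = Real.cos ((j - 1) * (2 * Real.pi / n)) := by
  rw [hV, ← Real.cos_neg]
  congr 1
  push_cast
  ring

lemma inner_zero_succ (hV : IsRegularSequence n V) (j : ℕ) :
    ⟪V 0, V (j + 1)⟫ = Real.cos ((j + 1) * (2 * Real.pi / n)) := by
  simpa using hV.inner_zero (j + 1)

lemma inner_one_succ (hV : IsRegularSequence n V) (j : ℕ) :
    ⟪V 1, V (j + 1)⟫ = Real.cos (j * (2 * Real.pi / n)) := by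
  simpa using hV.inner_one (j + 1)

lemma shift (hV : IsRegularSequence n V) (k : ℤ) : IsRegularSequence n fun j => V (k + j) := by
  intro a b
  rw [hV]
  congr 1
  push_cast
  ring

lemma reflect (hV : IsRegularSequence n V) (k : ℤ) : IsRegularSequence n fun j => V (k - j) := by
  intro a b
  rw [hV, ← Real.cos_neg]
  congr 1
  push_cast
  ring

/-- If `p` lies on the edge from `V 0` to `V 1` and `q` lies on an edge from `V j` to `V (j + 1)`
of the same half of the polygon, at distance less than the critical one from `p`, then the nearer
endpoint `V j` is at least as close to `p` as `q` is. -/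
lemma norm_vertex_sub_le (hn : 5 ≤ n) (hm : n = 2 * m + 1) (hV : IsRegularSequence n V)
    {t u : ℝ} (ht0 : 0 ≤ t) (ht1 : t ≤ 1) (hu0 : 0 ≤ u) {j : ℕ} (hj1 : 1 ≤ j) (hjm : j ≤ m)
    {p q : E} (hp : p = (1 - t) • V 0 + t • V 1) (hq : q = (1 - u) • V j + u • V (j + 1))
    (hpq : ‖q - p‖ < 1 + Real.cos (2 * Real.pi / n) / Real.cos (Real.pi / n)) :
    ‖V j - p‖ ≤ ‖q - p‖ := by
  have hc0 := cos_pi_div_pos hn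
  have hc1 := cos_pi_div_lt_one hn
  have h2 := cos_two_pi_div n
  set c := Real.cos (Real.pi / n)
  have ip0 := hV.inner_zero j
  have ip1 := hV.inner_one j
  have iq0 := hV.inner_zero_succ j
  have iq1 := hV.inner_one_succ j
  have is1 := hV.inner_self (j + 1)
  have is0 := hV.inner_self j
  have iss := hV.inner_succ j
  have hwe : ⟪V j - p, V (j + 1) - V j⟫ =
      (1 - t) * (⟪V 0, V j⟫ - ⟪V 0, V (j + 1)⟫) + t * (⟪V 1, V j⟫ - ⟪V 1, V (j + 1)⟫)
        - (2 - 2 * c ^ 2) := by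
    rw [hp]
    simp only [inner_sub_left, inner_sub_right, inner_add_left, real_inner_smul_left, is0, iss]
    ring
  rcases le_or_gt 0 ⟪V j - p, V (j + 1) - V j⟫ with h | h
  · have e : q - p = (V j - p) + u • (V (j + 1) - V j) := by rw [hq]; module
    rw [← sq_le_sq₀ (norm_nonneg _) (norm_nonneg _), e, norm_add_sq_real, real_inner_smul_right]
    nlinarith [sq_nonneg ‖u • (V (j + 1 : ℤ) - V j)‖, mul_nonneg hu0 h]
  · exfalso
    rw [hwe, ip0, ip1, iq0, iq1] at h
    obtain rfl | hlt := hjm.eq_or_lt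
    · rw [cos_half_turn hm, cos_half_turn_pred hm, cos_half_turn_succ hm] at h
      rw [cos_half_turn hm] at ip0 iq1
      rw [cos_half_turn_pred hm] at ip1
      rw [cos_half_turn_succ hm] at iq0
      have htc : 2 * c * t < 1 := by
        by_contra! hcon
        nlinarith [mul_nonneg (sub_nonneg.2 hcon) (show 0 ≤ 1 - c ^ 2 by nlinarith)]
      have hN : ‖V j + V (j + 1)‖ = 2 * c := by
        rw [← sq_eq_sq₀ (norm_nonneg _) (by positivity), norm_add_sq_real, iss,
          ← real_inner_self_eq_norm_sq, ← real_inner_self_eq_norm_sq, is0, is1]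
        ring
      have hcs := real_inner_le_norm (q - p) (V j + V (j + 1))
      have hin : ⟪q - p, V j + V (j + 1)⟫ = 2 * c * (1 + c - 2 * t * (1 - c ^ 2)) := by
        rw [hq, hp]
        simp only [inner_sub_left, inner_add_right, inner_add_left, real_inner_smul_left, is0, is1,
          iss, ip0, ip1, iq0, iq1, real_inner_comm (V j) (V (j + 1))]
        ring
      rw [hN, hin, mul_comm] at hcs
      have hcs' := le_of_mul_le_mul_right hcs (by positivity : 0 < 2 * c)
      have hR : 1 + Real.cos (2 * Real.pi / n) / c = 1 + c - (1 - c ^ 2) / c := by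
        rw [h2]; field_simp; ring
      have hlt' : 2 * t * (1 - c ^ 2) ≤ (1 - c ^ 2) / c := by
        rw [le_div_iff₀ hc0]
        nlinarith [mul_nonneg (sub_nonneg.2 htc.le) (show 0 ≤ 1 - c ^ 2 by nlinarith)]
      linarith
    · obtain ⟨i, rfl⟩ : ∃ i, j = i + 1 := ⟨j - 1, by omega⟩
      have h1 := one_sub_cos_le_cos_sub_cos hm (show (i + 1) + 1 ≤ m by omega)
      have h0 := one_sub_cos_le_cos_sub_cos hm (show i + 1 ≤ m by omega)
      push_cast at h h0 h1
      rw [add_sub_cancel_right] at h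
      rw [h2] at h0 h1
      nlinarith [mul_nonneg ht0 (sub_nonneg.2 h0),
        mul_nonneg (sub_nonneg.2 ht1) (sub_nonneg.2 h1)]

/-- On the half of the polygon starting with the edge containing `p`, every point of a subcritical
ball around `p` is joined to `p` inside the ball. -/
lemma exists_isPreconnected (hn : 5 ≤ n) (hm : n = 2 * m + 1) (hV : IsRegularSequence n V)
    {P : Set E} (hP : ∀ j : ℤ, segment ℝ (V j) (V (j + 1)) ⊆ P) {p : E}
    (hp : p ∈ segment ℝ (V 0) (V 1)) {r : ℝ}
    (hr : r < 1 + Real.cos (2 * Real.pi / n) / Real.cos (Real.pi / n)) {j : ℕ} (hj : j ≤ m) {q : E}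
    (hq : q ∈ segment ℝ (V j) (V (j + 1))) (hqr : q ∈ Metric.ball p r) :
    ∃ s ⊆ Metric.ball p r ∩ P, p ∈ s ∧ q ∈ s ∧ IsPreconnected s := by
  have hpr : p ∈ Metric.ball p r := Metric.mem_ball_self (Metric.pos_of_mem_ball hqr)
  induction j generalizing q with
  | zero =>
    refine ⟨segment ℝ p q, Set.subset_inter ((convex_ball p r).segment_subset hpr hqr) ?_,
      left_mem_segment ℝ p q, right_mem_segment ℝ p q, (convex_segment p q).isPreconnected⟩
    have := (convex_segment (𝕜 := ℝ) (V 0) (V 1)).segment_subset hp (by simpa using hq)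
    exact this.trans (by simpa using hP 0)
  | succ j ih =>
    have hv : V (j + 1 : ℕ) ∈ Metric.ball p r := by
      obtain ⟨t, ⟨ht0, ht1⟩, rfl⟩ := (segment_eq_image ℝ (V 0) (V 1)) ▸ hp
      obtain ⟨u, ⟨hu0, hu1⟩, rfl⟩ := (segment_eq_image ℝ (V (j + 1 : ℕ)) (V ((j + 1 : ℕ) + 1))) ▸ hq
      rw [mem_ball_iff_norm] at hqr ⊢
      exact (hV.norm_vertex_sub_le hn hm ht0 ht1 hu0 (by omega) hj rfl rfl
        (hqr.trans hr)).trans_lt hqr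
    obtain ⟨s, hs, hps, hvs, hsc⟩ := ih (by omega)
      (q := V (j + 1 : ℕ)) (by push_cast; exact right_mem_segment ℝ _ _) hv
    exact ⟨s ∪ segment ℝ (V (j + 1 : ℕ)) q,
      Set.union_subset hs (Set.subset_inter ((convex_ball p r).segment_subset hv hqr)
        (((convex_segment _ _).segment_subset (left_mem_segment ℝ _ _) hq).trans (hP _))),
      Or.inl hps, Or.inr (right_mem_segment ℝ _ _),
      hsc.union _ hvs (left_mem_segment ℝ _ _) (convex_segment _ _).isPreconnected⟩

end IsRegularSequence

end RegularSequence

section Polygon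

variable {n m : ℕ}

lemma isRegularSequence_nroot (n : ℕ) : IsRegularSequence n fun k : ℤ => nroot n ^ k := by
  intro a b
  have h (k : ℤ) : nroot n ^ k = Complex.exp (((k * (2 * Real.pi / n) : ℝ) : ℂ) * Complex.I) := by
    rw [nroot, ← Complex.exp_int_mul]
    congr 1
    push_cast
    ring
  simp only [h, Complex.inner]
  rw [← Complex.exp_conj, ← Complex.exp_add, sub_mul, ← Real.cos_neg, ← Complex.exp_ofReal_mul_I_re]
  congr 2
  simp only [map_mul, Complex.conj_ofReal, Complex.conj_I]
  push_cast
  ring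

lemma nroot_pow_self (hn : n ≠ 0) : nroot n ^ n = 1 :=
  (Complex.isPrimitiveRoot_exp n hn).pow_eq_one

lemma nroot_zpow_add_mul (hn : n ≠ 0) (k l : ℤ) : nroot n ^ (k + n * l) = nroot n ^ k := by
  have h0 : nroot n ≠ 0 := Complex.exp_ne_zero _
  rw [zpow_add₀ h0, zpow_mul, zpow_natCast, nroot_pow_self hn, one_zpow,
    mul_one]

lemma mem_polygon_iff {x : ℂ} : x ∈ polygon n ↔
    ∃ j < n, x ∈ segment ℝ (nroot n ^ (j : ℤ)) (nroot n ^ ((j : ℤ) + 1)) := by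
  simp only [polygon, Set.mem_iUnion, Finset.mem_range, exists_prop]
  norm_cast

lemma segment_nroot_subset_polygon (hn : n ≠ 0) (k : ℤ) :
    segment ℝ (nroot n ^ k) (nroot n ^ (k + 1)) ⊆ polygon n := by
  intro x hx
  have hn' : (n : ℤ) ≠ 0 := by exact_mod_cast hn
  have h0 := Int.emod_nonneg k hn'
  have h1 := Int.emod_lt_of_pos k (show (0 : ℤ) < n by omega)
  refine mem_polygon_iff.2 ⟨(k % n).toNat, by omega, ?_⟩
  rw [Int.toNat_of_nonneg h0, ← nroot_zpow_add_mul hn (k % n) (k / n),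
    ← nroot_zpow_add_mul hn (k % n + 1) (k / n), add_right_comm, Int.emod_add_mul_ediv]
  exact hx

/-- Subcritical balls centred on the polygon meet it in a connected set. -/
lemma isConnected_ball_inter_polygon (hn : 5 ≤ n) (hm : n = 2 * m + 1) {r : ℝ} (hr0 : 0 < r)
    (hr : r < 1 + Real.cos (2 * Real.pi / n) / Real.cos (Real.pi / n)) {p : ℂ}
    (hp : p ∈ polygon n) : IsConnected (Metric.ball p r ∩ polygon n) := by
  have hn0 : n ≠ 0 := by omega
  refine ⟨⟨p, Metric.mem_ball_self hr0, hp⟩, isPreconnected_of_forall p ?_⟩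
  rintro q ⟨hqr, hq⟩
  obtain ⟨k, hk, hpk⟩ := mem_polygon_iff.1 hp
  obtain ⟨l, hl, hql⟩ := mem_polygon_iff.1 hq
  have hV := isRegularSequence_nroot n
  have forward (i : ℕ) (hi : i ≤ m) (d : ℤ) (hd : (l : ℤ) + n * d = k + i) :
      ∃ s ⊆ Metric.ball p r ∩ polygon n, p ∈ s ∧ q ∈ s ∧ IsPreconnected s := by
    refine (hV.shift k).exists_isPreconnected hn hm (fun j => ?_) (by simpa using hpk) hr hi ?_ hqr
    · simpa only [add_assoc] using segment_nroot_subset_polygon hn0 (k + j)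
    · rw [← nroot_zpow_add_mul hn0 l d, ← nroot_zpow_add_mul hn0 (l + 1) d] at hql
      change q ∈ segment ℝ (nroot n ^ ((k : ℤ) + i)) (nroot n ^ ((k : ℤ) + (i + 1)))
      rwa [← hd, show (k : ℤ) + (i + 1) = l + 1 + n * d by omega]
  have backward (i : ℕ) (hi : i ≤ m) (d : ℤ) (hd : (l : ℤ) + n * d = k - i) :
      ∃ s ⊆ Metric.ball p r ∩ polygon n, p ∈ s ∧ q ∈ s ∧ IsPreconnected s := by
    refine (hV.reflect (k + 1)).exists_isPreconnected hn hm (fun j => ?_)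
      (by rw [segment_symm]; simpa using hpk) hr hi ?_ hqr
    · rw [segment_symm]
      change segment ℝ (nroot n ^ ((k : ℤ) + 1 - (j + 1))) (nroot n ^ ((k : ℤ) + 1 - j)) ⊆ polygon n
      rw [add_sub_add_right_eq_sub, add_sub_right_comm]
      exact segment_nroot_subset_polygon hn0 (k - j)
    · rw [← nroot_zpow_add_mul hn0 l d, ← nroot_zpow_add_mul hn0 (l + 1) d] at hql
      rw [segment_symm]
      change q ∈ segment ℝ (nroot n ^ ((k : ℤ) + 1 - (i + 1))) (nroot n ^ ((k : ℤ) + 1 - i))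
      rwa [add_sub_add_right_eq_sub, ← hd,
        show (k : ℤ) + 1 - i = l + 1 + n * d by omega]
  rcases le_total k l with h | h
  · by_cases h' : l - k ≤ m
    · exact forward (l - k) h' 0 (by omega)
    · exact backward (n - (l - k)) (by omega) (-1) (by omega)
  · by_cases h' : k - l ≤ m
    · exact backward (k - l) h' 0 (by omega)
    · exact forward (n - (k - l)) (by omega) 1 (by omega)

/-- All vertices but the two endpoints of the edge opposite to `1` lie strictly inside of the
supporting line of that edge. -/
lemma inner_vertex_add_lt (hn : 5 ≤ n) (hm : n = 2 * m + 1) {i : ℕ} (hi : i ≤ n) (him : i ≠ m)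
    (him' : i ≠ m + 1) :
    ⟪nroot n ^ (i : ℤ), nroot n ^ (m : ℤ) + nroot n ^ ((m : ℤ) + 1)⟫ <
      2 * Real.cos (Real.pi / n) ^ 2 := by
  have hn' : (0 : ℝ) < n := by positivity
  have hpi := Real.pi_pos
  have hV := isRegularSequence_nroot n
  have hc0 := cos_pi_div_pos hn
  rw [inner_add_right, hV i m, hV i (m + 1), Real.cos_add_cos]
  have e1 : ((((i : ℤ) : ℝ) - ((m : ℤ) : ℝ)) * (2 * Real.pi / n) +
      (((i : ℤ) : ℝ) - ((m + 1 : ℤ) : ℝ)) * (2 * Real.pi / n)) / 2 =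
      (2 * i - n) * (Real.pi / n) := by
    rw [hm]; push_cast; ring
  have e2 : ((((i : ℤ) : ℝ) - ((m : ℤ) : ℝ)) * (2 * Real.pi / n) -
      (((i : ℤ) : ℝ) - ((m + 1 : ℤ) : ℝ)) * (2 * Real.pi / n)) / 2 = Real.pi / n := by
    push_cast; ring
  rw [e1, e2]
  have habs : (1 : ℝ) < |2 * (i : ℝ) - n| ∧ |2 * (i : ℝ) - n| ≤ n := by
    have : (1 : ℤ) < |2 * (i : ℤ) - n| ∧ |2 * (i : ℤ) - n| ≤ n := by
      rw [lt_abs, abs_le]; omega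
    exact_mod_cast this
  have : Real.cos ((2 * i - n) * (Real.pi / n)) < Real.cos (Real.pi / n) := by
    rw [← Real.cos_abs ((2 * i - n) * _), abs_mul, abs_of_pos (show 0 < Real.pi / n by positivity)]
    apply Real.cos_lt_cos_of_nonneg_of_le_pi (by positivity)
    · calc |2 * (i : ℝ) - n| * (Real.pi / n) ≤ n * (Real.pi / n) := by gcongr; exact habs.2
        _ = Real.pi := by field_simp
    · exact lt_mul_of_one_lt_left (by positivity) habs.1
  nlinarith

/-- The edge opposite to `1` meets the other edges in its endpoints only. -/
lemma eq_or_eq_of_mem_segment_of_mem_segment (hn : 5 ≤ n) (hm : n = 2 * m + 1) {j : ℕ} (hj : j < n)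
    (hjm : j ≠ m) {x : ℂ} (hx : x ∈ segment ℝ (nroot n ^ (m : ℤ)) (nroot n ^ ((m : ℤ) + 1)))
    (hxj : x ∈ segment ℝ (nroot n ^ (j : ℤ)) (nroot n ^ ((j : ℤ) + 1))) :
    x = nroot n ^ (m : ℤ) ∨ x = nroot n ^ ((m : ℤ) + 1) := by
  have hV := isRegularSequence_nroot n
  have i0 := hV.inner_self m
  have i1 := hV.inner_self (m + 1)
  have i2 := hV.inner_succ m
  have hlt (i : ℕ) := inner_vertex_add_lt (i := i) hn hm
  have hlt' := hlt (j + 1)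
  push_cast at hlt'
  have hm0 : ⟪nroot n ^ (m : ℤ), nroot n ^ (m : ℤ) + nroot n ^ ((m : ℤ) + 1)⟫ =
      2 * Real.cos (Real.pi / n) ^ 2 := by
    rw [inner_add_right, i0, i2]; ring
  have hm1 : ⟪nroot n ^ ((m : ℤ) + 1), nroot n ^ (m : ℤ) + nroot n ^ ((m : ℤ) + 1)⟫ =
      2 * Real.cos (Real.pi / n) ^ 2 := by
    rw [inner_add_right, real_inner_comm, i1, i2]; ring
  have hN : ⟪x, nroot n ^ (m : ℤ) + nroot n ^ ((m : ℤ) + 1)⟫ =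
      2 * Real.cos (Real.pi / n) ^ 2 := by
    obtain ⟨a, b, -, -, hab, rfl⟩ := hx
    rw [inner_add_left, real_inner_smul_left, real_inner_smul_left, hm0, hm1, ← add_mul, hab,
      one_mul]
  obtain ⟨a, b, ha, hb, hab, rfl⟩ := hxj
  rw [inner_add_left, real_inner_smul_left, real_inner_smul_left] at hN
  obtain rfl | ha := ha.eq_or_lt
  · obtain rfl : b = 1 := by linarith
    by_cases h : j + 1 = m
    · left
      rw [← h]; simp
    · have := hlt' hj h (by omega)
      linarith
  obtain rfl | hb := hb.eq_or_lt
  · obtain rfl : a = 1 := by linarith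
    by_cases h : j = m + 1
    · right
      rw [h]; simp
    · have := hlt j hj.le hjm h
      linarith
  exfalso
  have hmul : a * (2 * Real.cos (Real.pi / n) ^ 2) + b * (2 * Real.cos (Real.pi / n) ^ 2) =
      2 * Real.cos (Real.pi / n) ^ 2 := by rw [← add_mul, hab, one_mul]
  by_cases h : j = m + 1
  · have h1 := hlt' hj (by omega) (by omega)
    rw [h] at hN h1
    push_cast at hN h1
    rw [hm1] at hN
    have := mul_lt_mul_of_pos_left h1 hb
    linarith
  · have h1 := mul_lt_mul_of_pos_left (hlt j hj.le hjm h) ha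
    by_cases h' : j + 1 = m
    · have : ((j : ℤ) + 1) = m := by omega
      rw [this, hm0] at hN
      linarith
    · have h2 := mul_lt_mul_of_pos_left (hlt' hj h' (by omega)) hb
      linarith

/-- A ball centred on the edge from `1` to `ω` that meets the opposite edge but contains neither of
its endpoints meets the polygon in a disconnected set. -/
lemma not_isConnected_ball_inter_polygon (hn : 5 ≤ n) (hm : n = 2 * m + 1) {p q : ℂ} {r : ℝ}
    (hp : p ∈ segment ℝ (nroot n ^ (0 : ℤ)) (nroot n ^ (1 : ℤ)))
    (hq : q ∈ segment ℝ (nroot n ^ (m : ℤ)) (nroot n ^ ((m : ℤ) + 1)))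
    (hqr : q ∈ Metric.ball p r) (h0 : nroot n ^ (m : ℤ) ∉ Metric.ball p r)
    (h1 : nroot n ^ ((m : ℤ) + 1) ∉ Metric.ball p r) :
    ¬ IsConnected (Metric.ball p r ∩ polygon n) := by
  intro hcon
  have hclosed (a b : ℂ) : IsClosed (segment ℝ a b) := by
    rw [← convexHull_pair]
    exact (Set.toFinite _).isClosed_convexHull ℝ
  have hn0 : n ≠ 0 := by omega
  have hpP : p ∈ polygon n := segment_nroot_subset_polygon hn0 0 (by simpa using hp)
  obtain ⟨x, ⟨hxr, -⟩, hxm, hxo⟩ := isPreconnected_closed_iff.1 hcon.isPreconnected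
    (segment ℝ (nroot n ^ (m : ℤ)) (nroot n ^ ((m : ℤ) + 1)))
    (⋃ j ∈ (Finset.range n).erase m, segment ℝ (nroot n ^ (j : ℤ)) (nroot n ^ ((j : ℤ) + 1)))
    (hclosed _ _) (isClosed_biUnion_finset fun _ _ => hclosed _ _)
    (by
      rintro x ⟨-, hx⟩
      obtain ⟨j, hj, hxj⟩ := mem_polygon_iff.1 hx
      by_cases h : j = m
      · exact Or.inl (h ▸ hxj)
      · exact Or.inr (Set.mem_biUnion (by simp [h, hj]) hxj))
    ⟨q, ⟨hqr, segment_nroot_subset_polygon hn0 _ hq⟩, hq⟩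
    ⟨p, ⟨Metric.mem_ball_self (Metric.pos_of_mem_ball hqr), hpP⟩,
      Set.mem_biUnion (x := 0) (by simp; omega) (by simpa using hp)⟩
  simp only [Set.mem_iUnion, Finset.mem_erase, Finset.mem_range, exists_prop] at hxo
  obtain ⟨j, ⟨hjm, hj⟩, hxj⟩ := hxo
  rcases eq_or_eq_of_mem_segment_of_mem_segment hn hm hj hjm hxm hxj with rfl | rfl
  · exact h0 hxr
  · exact h1 hxr

/-- Above the critical radius there are disconnected balls. -/
lemma exists_not_isConnected_ball_inter_polygon (hn : 5 ≤ n) (hm : n = 2 * m + 1) {r : ℝ}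
    (hr : 1 + Real.cos (2 * Real.pi / n) / Real.cos (Real.pi / n) < r) :
    ∃ r', 0 < r' ∧ r' < r ∧ ∃ p ∈ polygon n, ¬ IsConnected (Metric.ball p r' ∩ polygon n) := by
  have hc0 := cos_pi_div_pos hn
  have hc1 := cos_pi_div_lt_one hn
  have h2 := cos_two_pi_div n
  have hd0 := cos_two_pi_div_pos hn
  have hV := isRegularSequence_nroot n
  set V : ℤ → ℂ := fun k => nroot n ^ k with hVdef
  have ip0 := hV.inner_zero m
  have ip1 := hV.inner_one m
  have iq0 := hV.inner_zero_succ m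
  have iq1 := hV.inner_one_succ m
  rw [cos_half_turn hm] at ip0 iq1
  rw [cos_half_turn_pred hm] at ip1
  rw [cos_half_turn_succ hm] at iq0
  have i00 := hV.inner_self 0
  have i11 := hV.inner_self 1
  have i01 := hV.inner_zero_one
  have iss := hV.inner_succ m
  have is0 := hV.inner_self m
  have is1 := hV.inner_self (m + 1)
  set c := Real.cos (Real.pi / n)
  set R := 1 + Real.cos (2 * Real.pi / n) / c with hR
  have hR0 : 0 < R := by positivity
  have hs : 0 < 1 - c ^ 2 := by nlinarith
  have hc2 : 1 < 2 * c := by nlinarith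
  obtain ⟨t, ht0, htc, htr⟩ : ∃ t : ℝ, 0 ≤ t ∧ 2 * t * c < 1 ∧
      1 + c - 2 * t * (1 - c ^ 2) < r := by
    set ε := min (1 / (2 * c)) ((r - R) / 3)
    have he0 : 0 < ε := lt_min (by positivity) (by linarith)
    have he1 : ε ≤ 1 / (2 * c) := min_le_left _ _
    have he2 : ε ≤ (r - R) / 3 := min_le_right _ _
    refine ⟨1 / (2 * c) - ε, by linarith, ?_, ?_⟩
    · have : 2 * (1 / (2 * c) - ε) * c = 1 - 2 * ε * c := by field_simp
      rw [this]
      nlinarith [mul_pos he0 hc0]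
    · have : 1 + c - 2 * (1 / (2 * c) - ε) * (1 - c ^ 2) = R + 2 * ε * (1 - c ^ 2) := by
        rw [hR, h2]; field_simp; ring
      rw [this]
      nlinarith [mul_nonneg he0.le (sq_nonneg c)]
  have ht1 : t < 1 := by nlinarith
  set u := (1 - 2 * t * c) / 2 with hu
  have hu0 : 0 < u := by linarith
  have hu1 : u ≤ 1 / 2 := by nlinarith [mul_nonneg ht0 hc0.le]
  set d := 1 + c - 2 * t * (1 - c ^ 2) with hd
  have hdR : 0 < d := by nlinarith
  set p := (1 - t) • V 0 + t • V 1 with hp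
  set q := (1 - u) • V m + u • V (m + 1) with hq
  have comm := fun a b : ℂ => real_inner_comm a b
  have nq : ‖q - p‖ ^ 2 = d ^ 2 := by
    rw [← real_inner_self_eq_norm_sq, hq, hp]
    simp only [inner_sub_left, inner_sub_right, inner_add_right, inner_add_left,
      real_inner_smul_left, real_inner_smul_right, is0, is1, iss, ip0, ip1, iq0, iq1, i00, i11, i01,
      comm (V 0) (V m), comm (V 0) (V (m + 1)), comm (V 1) (V m), comm (V 1) (V (m + 1)),
      comm (V 0) (V 1), comm (V m) (V (m + 1))]
    rw [hd, hu]
    ring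
  have n0 : ‖V m - p‖ ^ 2 = d ^ 2 + 4 * u ^ 2 * (1 - c ^ 2) := by
    rw [← real_inner_self_eq_norm_sq, hp]
    simp only [inner_sub_left, inner_sub_right, inner_add_right, inner_add_left,
      real_inner_smul_left, real_inner_smul_right, is0, ip0, ip1, i00, i11, i01,
      comm (V 0) (V m), comm (V 1) (V m), comm (V 0) (V 1)]
    rw [hd, hu]
    ring
  have n1 : ‖V (m + 1) - p‖ ^ 2 = d ^ 2 + 4 * (1 - u) ^ 2 * (1 - c ^ 2) := by
    rw [← real_inner_self_eq_norm_sq, hp]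
    simp only [inner_sub_left, inner_sub_right, inner_add_right, inner_add_left,
      real_inner_smul_left, real_inner_smul_right, is1, iq0, iq1, i00, i11, i01,
      comm (V 0) (V (m + 1)), comm (V 1) (V (m + 1)), comm (V 0) (V 1)]
    rw [hd, hu]
    ring
  have nq' : ‖q - p‖ = d := (sq_eq_sq₀ (norm_nonneg _) hdR.le).1 nq
  have n0' : d < ‖V m - p‖ := by
    rw [← sq_lt_sq₀ hdR.le (norm_nonneg _), n0]
    have : 0 < 4 * u ^ 2 * (1 - c ^ 2) := by positivity
    linarith
  have n01 : ‖V m - p‖ ≤ ‖V (m + 1) - p‖ := by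
    rw [← sq_le_sq₀ (norm_nonneg _) (norm_nonneg _), n0, n1]
    gcongr
    linarith
  obtain ⟨r', hr1, hr2⟩ := exists_between (lt_min htr n0')
  have hps : p ∈ segment ℝ (V 0) (V 1) := ⟨1 - t, t, by linarith, ht0, by ring, rfl⟩
  refine ⟨r', hdR.trans hr1, hr2.trans_le (min_le_left _ _), p,
    segment_nroot_subset_polygon (by omega) 0 (by simpa [hVdef] using hps),
    not_isConnected_ball_inter_polygon hn hm hps
      (q := q) ⟨1 - u, u, by linarith, hu0.le, by ring, rfl⟩ ?_ ?_ ?_⟩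
  · rwa [mem_ball_iff_norm, nq']
  · rw [mem_ball_iff_norm, not_lt]
    exact hr2.le.trans (min_le_right _ _)
  · rw [mem_ball_iff_norm, not_lt]
    exact (hr2.le.trans (min_le_right _ _)).trans n01

end Polygon


/-- For an odd integer `n ≥ 5`, the supremum of the set of `r > 0` such that for all
`0 < r' < r` and all `p ∈ P_n`, the set `B(p,r') ∩ P_n` is connected,
equals `1 + cos(2π/n)/cos(π/n)`. -/
theorem connectivity_scale_odd (n : ℕ) (hn : 5 ≤ n) (hodd : Odd n) :
    sSup {r : ℝ | 0 < r ∧ ∀ r' : ℝ, 0 < r' → r' < r → ∀ p ∈ polygon n,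
        IsConnected (Metric.ball p r' ∩ polygon n)} =
      1 + Real.cos (2 * Real.pi / n) / Real.cos (Real.pi / n) := by
  obtain ⟨m, hm⟩ := hodd
  refine IsGreatest.csSup_eq ⟨⟨?_, ?_⟩, ?_⟩
  · have := cos_pi_div_pos hn
    have := cos_two_pi_div_pos hn
    positivity
  · exact fun r' h0 hr p hp => isConnected_ball_inter_polygon hn hm h0 hr hp
  · rintro r ⟨-, hr⟩
    by_contra! hlt
    obtain ⟨r', h0, hr', p, hp, hnot⟩ := exists_not_isConnected_ball_inter_polygon hn hm hlt
    exact hnot (hr r' h0 hr' p hp)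
end

section
/- Let G = (V, E) be a finite cyclic graph and let f : V → V be its associated dynamical system. Then all periodic orbits of f have the same length ℓ and the same winding number ω; that is, if u and w are periodic vertices with orbit lengths ℓ_u, ℓ_w and winding numbers ω_u, ω_w, then ℓ_u = ℓ_w and ω_u = ω_w. -/
/-- A finite cyclic graph: a finite directed graph whose vertices lie in `[0,1)`
(identified with the circle `S¹`), with no loops and no edges oriented in both directions,
such that whenever there is an edge `u → u₁`, there are also edges `u → w → u₁` for every
vertex `w` strictly counterclockwise-between `u` and `u₁`.  Here the normalized
counterclockwise distance from `x` to `y` on the circle is `Int.fract (y - x)`. -/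
structure FiniteCyclicGraph where
  /-- The (finite) vertex set, a subset of `[0,1)`. -/
  V : Finset ℝ
  /-- The edge relation. -/
  E : ℝ → ℝ → Prop
  mem_Ico : ∀ u ∈ V, u ∈ Set.Ico (0 : ℝ) 1
  edge_mem : ∀ u w, E u w → u ∈ V ∧ w ∈ V
  no_loops : ∀ u, ¬ E u u
  no_double : ∀ u w, E u w → ¬ E w u
  cyclic : ∀ u w z, E u w → z ∈ V →
    0 < Int.fract (z - u) → Int.fract (z - u) < Int.fract (w - u) → E u z ∧ E z w

namespace FiniteCyclicGraph

variable (G : FiniteCyclicGraph)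

/-- The preimage of the vertex set under the universal covering `ℝ → S¹`. -/
def cover : Set ℝ := {x | Int.fract x ∈ G.V}

/-- The deck transformation `x ↦ x + n` of the cover. -/
def shift (n : ℤ) (x : G.cover) : G.cover :=
  ⟨x + n, by simpa [cover] using x.2⟩

theorem shift_strictMono (n : ℤ) : StrictMono (G.shift n) := by
  intro x y h
  have h' : (x : ℝ) < y := h
  simpa [shift, ← Subtype.coe_lt_coe] using h'

theorem coe_shift_iterate (n : ℤ) (k : ℕ) (x : G.cover) :
    (((G.shift n)^[k] x : G.cover) : ℝ) = x + k * n := by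
  induction k with
  | zero => simp
  | succ k ih =>
    rw [Function.iterate_succ_apply']
    simp only [shift] at ih ⊢
    rw [ih]
    push_cast
    ring

theorem fract_of_mem {u : ℝ} (hu : u ∈ G.V) : Int.fract u = u :=
  Int.fract_eq_self.2 (G.mem_Ico u hu)

variable {G} {f : ℝ → ℝ}

theorem fract_add_fract_sub_fract {x v : ℝ} (hv : v ∈ G.V) :
    Int.fract (x + Int.fract (v - Int.fract x)) = v := by
  obtain ⟨h0, h1⟩ := G.mem_Ico v hv
  refine Int.fract_eq_iff.2 ⟨h0, h1, ⌊x⌋ - ⌊v - Int.fract x⌋, ?_⟩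
  have h2 := Int.self_sub_floor (v - Int.fract x)
  have h3 := Int.self_sub_floor x
  push_cast
  linarith

/-- The lift of a self-map of the vertex set to the cover, moving each point counterclockwise
by less than a full turn. -/
noncomputable def lift (hf : ∀ u ∈ G.V, f u ∈ G.V) (x : G.cover) : G.cover :=
  ⟨x + Int.fract (f (Int.fract (x : ℝ)) - Int.fract (x : ℝ)), by
    have h := hf _ x.2
    rwa [← fract_add_fract_sub_fract (x := x) h] at h⟩

theorem fract_lift_iterate (hf : ∀ u ∈ G.V, f u ∈ G.V) (n : ℕ) (x : G.cover) :
    Int.fract ((lift hf)^[n] x : ℝ) = f^[n] (Int.fract (x : ℝ)) := by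
  induction n with
  | zero => rfl
  | succ n ih =>
    rw [Function.iterate_succ_apply', Function.iterate_succ_apply', ← ih]
    exact fract_add_fract_sub_fract (hf _ ((lift hf)^[n] x).2)

theorem coe_lift_iterate (hf : ∀ u ∈ G.V, f u ∈ G.V) (n : ℕ) (x : G.cover) :
    ((lift hf)^[n] x : ℝ) = x + ∑ j ∈ Finset.range n,
      Int.fract (f^[j + 1] (Int.fract (x : ℝ)) - f^[j] (Int.fract (x : ℝ))) := by
  induction n with
  | zero => simp
  | succ n ih =>
    rw [Finset.sum_range_succ, ← add_assoc, ← ih, Function.iterate_succ_apply',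
      Function.iterate_succ_apply', ← fract_lift_iterate hf]
    rfl

theorem lift_commute_shift (hf : ∀ u ∈ G.V, f u ∈ G.V) (n : ℤ) :
    Function.Commute (lift hf) (G.shift n) := by
  intro x
  apply Subtype.ext
  simp only [lift, shift, Int.fract_add_intCast]
  ring

theorem lift_monotone (hf : ∀ u ∈ G.V, f u ∈ G.V)
    (hf_mem : ∀ u ∈ G.V, f u = u ∨ G.E u (f u))
    (hf_max : ∀ u ∈ G.V, ∀ w, G.E u w → Int.fract (w - u) ≤ Int.fract (f u - u)) :
    Monotone (lift hf) := by
  refine monotone_iff_forall_lt.2 ?_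
  rintro ⟨x, hx⟩ ⟨y, hy⟩ hxy
  replace hxy : x < y := hxy
  replace hx : Int.fract x ∈ G.V := hx
  replace hy : Int.fract y ∈ G.V := hy
  change x + Int.fract (f (Int.fract x) - Int.fract x) ≤
    y + Int.fract (f (Int.fract y) - Int.fract y)
  have hd := Int.fract_lt_one (f (Int.fract x) - Int.fract x)
  have hy0 := Int.fract_nonneg (f (Int.fract y) - Int.fract y)
  rcases le_or_gt (x + Int.fract (f (Int.fract x) - Int.fract x)) y with h | h
  · linarith
  have hx' := Int.self_sub_floor x
  have hy' := Int.self_sub_floor y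
  have hyx : Int.fract (Int.fract y - Int.fract x) = y - x :=
    Int.fract_eq_iff.2 ⟨by linarith, by linarith, ⌊x⌋ - ⌊y⌋, by push_cast; linarith⟩
  have hE : G.E (Int.fract x) (f (Int.fract x)) := by
    refine (hf_mem _ hx).resolve_left fun he => ?_
    rw [he, sub_self, Int.fract_zero] at h
    linarith
  have hE' := (G.cyclic _ _ _ hE hy (by linarith) (by linarith)).2
  have hfy : Int.fract (f (Int.fract x) - Int.fract y) =
      x + Int.fract (f (Int.fract x) - Int.fract x) - y := by
    have h2 := Int.self_sub_floor (f (Int.fract x) - Int.fract x)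
    exact Int.fract_eq_iff.2 ⟨by linarith, by linarith,
      ⌊y⌋ - ⌊x⌋ + ⌊f (Int.fract x) - Int.fract x⌋, by push_cast; linarith⟩
  have := hf_max _ hy _ hE'
  linarith

theorem lift_iterate_mul_eq (hf : ∀ u ∈ G.V, f u ∈ G.V) {x : G.cover} {n : ℕ} {p : ℤ}
    (h : (lift hf)^[n] x = G.shift p x) (k : ℕ) :
    (lift hf)^[n * k] x = (G.shift p)^[k] x := by
  rw [Function.iterate_mul]
  induction k with
  | zero => rfl
  | succ k ih =>
    rw [Function.iterate_succ_apply, h,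
      (((lift_commute_shift hf p).iterate_left n).iterate_left k).eq, ih,
      Function.iterate_succ_apply']

/-- The lift moves a periodic vertex by its winding number, an integer coprime to the length. -/
theorem exists_winding_of_periodic (hf : ∀ u ∈ G.V, f u ∈ G.V) (hmono : Monotone (lift hf))
    {u : ℝ} (hu : u ∈ G.V) {n : ℕ} (hn : 0 < n) (hper : f^[n] u = u)
    (hmin : ∀ i : ℕ, 0 < i → f^[i] u = u → n ≤ i) :
    ∃ p : ℤ, ∑ j ∈ Finset.range n, Int.fract (f^[j + 1] u - f^[j] u) = p ∧
      IsCoprime (n : ℤ) p ∧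
      ∀ x : G.cover, (x : ℝ) = u → (lift hf)^[n] x = G.shift p x := by
  have hfu := G.fract_of_mem hu
  let x : G.cover := ⟨u, by simpa [cover, hfu] using hu⟩
  have hsum := coe_lift_iterate hf n x
  have hfr := fract_lift_iterate hf n x
  simp only [x, hfu] at hsum hfr
  rw [hper] at hfr
  have hfl := Int.self_sub_floor ((lift hf)^[n] x : ℝ)
  obtain ⟨p, hp⟩ : ∃ p : ℤ, p = ⌊((lift hf)^[n] x : ℝ)⌋ := ⟨_, rfl⟩
  rw [← hp] at hfl
  have hx : (lift hf)^[n] x = G.shift p x := by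
    apply Subtype.ext
    simp only [shift, x] at hfl ⊢
    linarith
  refine ⟨p, by simp only [x] at hfl; linarith, ?_, fun y hy => ?_⟩
  · rw [Int.isCoprime_iff_gcd_eq_one]
    obtain ⟨m, hm⟩ : Int.gcd n p ∣ n := Int.natCast_dvd_natCast.1 (Int.gcd_dvd_left ..)
    obtain ⟨q, hq⟩ : (Int.gcd n p : ℤ) ∣ p := Int.gcd_dvd_right ..
    set d := Int.gcd n p
    have hd : 0 < d := Nat.pos_of_ne_zero fun h => by simp [h] at hm; omega
    have hm0 : 0 < m := Nat.pos_of_ne_zero fun h => by simp [h] at hm; omega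
    have hroot : (lift hf)^[m] x = G.shift q x := by
      refine (((lift_commute_shift hf q).iterate_left m).iterate_pos_eq_iff_map_eq
        (hmono.iterate m) (G.shift_strictMono q) hd).1 ?_
      rw [← Function.iterate_mul, mul_comm, ← hm, hx]
      apply Subtype.ext
      rw [coe_shift_iterate]
      simp only [shift]
      rw [hq]
      push_cast
      ring
    have hfm := fract_lift_iterate hf m x
    rw [hroot] at hfm
    simp only [shift, x, Int.fract_add_intCast, hfu] at hfm
    have := hmin m hm0 hfm.symm
    nlinarith
  · rwa [show y = x from Subtype.ext hy]

theorem mul_winding_le (hf : ∀ u ∈ G.V, f u ∈ G.V) (hmono : Monotone (lift hf))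
    {x y : G.cover} (hxy : (x : ℝ) < y + 1) (hyx : (y : ℝ) < x + 1) {m n : ℕ} {p q : ℤ}
    (hx : (lift hf)^[m] x = G.shift p x) (hy : (lift hf)^[n] y = G.shift q y) :
    n * p ≤ m * q := by
  have hle : x ≤ G.shift 1 y := by
    change (x : ℝ) ≤ y + (1 : ℤ)
    push_cast
    exact hxy.le
  have h := hmono.iterate (m * (n * 2)) hle
  rw [((lift_commute_shift hf 1).iterate_left _).eq, lift_iterate_mul_eq hf hx,
    show m * (n * 2) = n * (m * 2) by ring, lift_iterate_mul_eq hf hy] at h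
  have h' : (((G.shift p)^[n * 2] x : G.cover) : ℝ) ≤
    ((G.shift q)^[m * 2] y : G.cover) + (1 : ℤ) := h
  rw [coe_shift_iterate, coe_shift_iterate] at h'
  push_cast at h'
  have h2 : ((n * p : ℤ) : ℝ) < (m * q + 1 : ℤ) := by
    push_cast
    linarith
  exact Int.lt_add_one_iff.1 (Int.cast_lt.1 h2)

end FiniteCyclicGraph

/-- All periodic orbits of the dynamical system associated to a finite cyclic graph have the
same length and the same winding number.  Here `f` is the dynamical system of `G`: for each
vertex `u`, `f u` is the element of `N⁺[G,u] = {u} ∪ {w | E u w}` maximizing the normalized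
counterclockwise distance from `u` (so `f u = u` when `u` has no out-neighbors). If `u` and `w`
are periodic vertices with (least) orbit lengths `ℓu`, `ℓw`, then `ℓu = ℓw` and the winding
numbers `Σ_{j<ℓu} d(f^j u, f^(j+1) u)` and `Σ_{j<ℓw} d(f^j w, f^(j+1) w)` agree. -/
theorem periodic_orbits_same_length_and_winding (G : FiniteCyclicGraph) (f : ℝ → ℝ)
    (hf_mem : ∀ u ∈ G.V, f u = u ∨ G.E u (f u))
    (hf_max : ∀ u ∈ G.V, ∀ w, G.E u w → Int.fract (w - u) ≤ Int.fract (f u - u))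
    (u w : ℝ) (hu : u ∈ G.V) (hw : w ∈ G.V)
    (ℓu ℓw : ℕ) (hℓu : 0 < ℓu) (hℓw : 0 < ℓw)
    (hpu : f^[ℓu] u = u) (hpw : f^[ℓw] w = w)
    (hminu : ∀ i : ℕ, 0 < i → f^[i] u = u → ℓu ≤ i)
    (hminw : ∀ i : ℕ, 0 < i → f^[i] w = w → ℓw ≤ i) :
    ℓu = ℓw ∧
      ∑ j ∈ Finset.range ℓu, Int.fract (f^[j + 1] u - f^[j] u) =
        ∑ j ∈ Finset.range ℓw, Int.fract (f^[j + 1] w - f^[j] w) := by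
  have hf : ∀ v ∈ G.V, f v ∈ G.V := fun v hv =>
    (hf_mem v hv).elim (fun h => h.symm ▸ hv) fun h => (G.edge_mem _ _ h).2
  have hmono := FiniteCyclicGraph.lift_monotone hf hf_mem hf_max
  obtain ⟨p, hp, hcp, hlp⟩ :=
    FiniteCyclicGraph.exists_winding_of_periodic hf hmono hu hℓu hpu hminu
  obtain ⟨q, hq, hcq, hlq⟩ :=
    FiniteCyclicGraph.exists_winding_of_periodic hf hmono hw hℓw hpw hminw
  have hx := hlp ⟨u, by simpa [FiniteCyclicGraph.cover, G.fract_of_mem hu] using hu⟩ rfl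
  have hy := hlq ⟨w, by simpa [FiniteCyclicGraph.cover, G.fract_of_mem hw] using hw⟩ rfl
  obtain ⟨hu0, hu1⟩ := G.mem_Ico u hu
  obtain ⟨hw0, hw1⟩ := G.mem_Ico w hw
  have hxy : u < w + 1 := by linarith
  have hyx : w < u + 1 := by linarith
  have heq : (ℓw : ℤ) * p = ℓu * q :=
    le_antisymm (FiniteCyclicGraph.mul_winding_le hf hmono hxy hyx hx hy)
      (FiniteCyclicGraph.mul_winding_le hf hmono hyx hxy hy hx)
  have hℓ : ℓu = ℓw := Nat.dvd_antisymm
    (Int.natCast_dvd_natCast.1 (hcp.dvd_of_dvd_mul_right ⟨q, heq⟩))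
    (Int.natCast_dvd_natCast.1 (hcq.dvd_of_dvd_mul_right ⟨p, heq.symm⟩))
  refine ⟨hℓ, ?_⟩
  rw [hp, hq]
  rw [hℓ] at heq
  exact congrArg _ (mul_left_cancel₀ (by omega) heq)
end
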